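/- Let β ∈ ℝ and a, b ∈ ℝ, set δ = (3/8) β a² and φ(ρ) = ρ + δ ln ρ + b. Then for every ρ > 0: L(a cos φ)(ρ) = (−δ²/ρ² + 1/(4ρ²)) a cos φ(ρ) + (δ/ρ²) a sin φ(ρ) + (2δ/(3ρ)) a cos 3φ(ρ). -/

import Mathlib

open Real

/-- The nonlinear ODE operator `L(g)(ρ) = g'' + (1 + (β/ρ)g² + 1/(4ρ²))g`. -/
noncomputable def Lop (β : ℝ) (g : ℝ → ℝ) (ρ : ℝ) : ℝ :=
  deriv (deriv g) ρ + (1 + β / ρ * (g ρ) ^ 2 + 1 / (4 * ρ ^ 2)) * g ρ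

/-- The phase `r + δ log r + b` has derivative `1 + δ / r` away from the origin. -/
lemma hasDerivAt_log_phase (δ b : ℝ) {r : ℝ} (hr : r ≠ 0) :
    HasDerivAt (fun r => r + δ * Real.log r + b) (1 + δ / r) r := by
  simpa [div_eq_mul_inv] using
    ((hasDerivAt_id' r).add ((Real.hasDerivAt_log hr).const_mul δ)).add_const b

lemma deriv_deriv_cos_log_phase (a δ b : ℝ) {ρ : ℝ} (hρ : ρ ≠ 0) :
    deriv (deriv fun r => a * Real.cos (r + δ * Real.log r + b)) ρ =
      -a * Real.cos (ρ + δ * Real.log ρ + b) * (1 + δ / ρ) ^ 2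
        + a * Real.sin (ρ + δ * Real.log ρ + b) * (δ / ρ ^ 2) := by
  have h₁ : deriv (fun r => a * Real.cos (r + δ * Real.log r + b)) =ᶠ[nhds ρ]
      fun r => a * (-Real.sin (r + δ * Real.log r + b) * (1 + δ * r⁻¹)) := by
    filter_upwards [isOpen_ne.mem_nhds hρ] with r hr
    simpa only [div_eq_mul_inv] using ((hasDerivAt_log_phase δ b hr).cos.const_mul a).deriv
  have h₂ := (((hasDerivAt_log_phase δ b hρ).sin.fun_neg.fun_mul
    (((hasDerivAt_inv hρ).const_mul δ).const_add 1)).const_mul a).deriv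
  rw [h₁.deriv_eq, h₂]
  field_simp

/-- With `δ = (3/8)βa²` and `φ(ρ) = ρ + δ log ρ + b`:
`L(a cos φ) = (−δ²/ρ² + 1/(4ρ²)) a cos φ + (δ/ρ²) a sin φ + (2δ/(3ρ)) a cos 3φ`. -/
theorem L_of_leading_profile (β a b : ℝ) :
    ∀ ρ : ℝ, 0 < ρ →
      Lop β (fun r => a * Real.cos (r + (3 / 8) * β * a ^ 2 * Real.log r + b)) ρ =
        (-((3 / 8) * β * a ^ 2) ^ 2 / ρ ^ 2 + 1 / (4 * ρ ^ 2)) * a *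
            Real.cos (ρ + (3 / 8) * β * a ^ 2 * Real.log ρ + b)
        + ((3 / 8) * β * a ^ 2) / ρ ^ 2 * a *
            Real.sin (ρ + (3 / 8) * β * a ^ 2 * Real.log ρ + b)
        + (2 * ((3 / 8) * β * a ^ 2) / (3 * ρ)) * a *
            Real.cos (3 * (ρ + (3 / 8) * β * a ^ 2 * Real.log ρ + b)) := by
  intro ρ hρ
  rw [Lop, deriv_deriv_cos_log_phase a _ b hρ.ne', Real.cos_three_mul]
  field_simp
  ring
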